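/- Let M be a spacetime and τ a time function on M. If τ is locally anti-Lipschitz, then the induced null distance d̂_τ is a definite (i.e. d̂_τ(p,q) = 0 iff p = q) and conformally invariant metric on M that induces the manifold topology. -/

import Mathlib

open Manifold Set Filter Topology

noncomputable section

namespace SpacetimeNullDist

variable {n : ℕ} {M : Type*} [TopologicalSpace M] [T2Space M]
  [ChartedSpace (EuclideanSpace ℝ (Fin (n + 1))) M]
  [IsManifold (𝓡 (n + 1)) (⊤ : ℕ∞) M]

/-- `g` is a (smooth) Lorentzian metric on the manifold `M`: a symmetric
bilinear form on each tangent space, of signature `(-,+,…,+)` (witnessed by a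
pseudo-orthonormal basis at each point), whose associated quadratic form is
smooth on the tangent bundle. -/
def IsLorentzMetric
    (g : ∀ x : M, TangentSpace (𝓡 (n + 1)) x → TangentSpace (𝓡 (n + 1)) x → ℝ) : Prop :=
  (∀ x u v, g x u v = g x v u) ∧
  (∀ x u, IsLinearMap ℝ (g x u)) ∧
  (∀ x : M, ∃ e : Module.Basis (Fin (n + 1)) ℝ (TangentSpace (𝓡 (n + 1)) x),
    ∀ i j, g x (e i) (e j) =
      if i = j then (if i = (0 : Fin (n + 1)) then -1 else 1) else 0) ∧
  ContMDiff ((𝓡 (n + 1)).tangent) 𝓘(ℝ, ℝ) (⊤ : ℕ∞)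
    (fun v : TangentBundle (𝓡 (n + 1)) M => g v.proj v.2 v.2)

/-- `T` is a time orientation of `(M,g)`: a continuous timelike vector field. -/
def IsTimeOrientation
    (g : ∀ x : M, TangentSpace (𝓡 (n + 1)) x → TangentSpace (𝓡 (n + 1)) x → ℝ)
    (T : ∀ x : M, TangentSpace (𝓡 (n + 1)) x) : Prop :=
  Continuous (fun x : M => (⟨x, T x⟩ : TangentBundle (𝓡 (n + 1)) M)) ∧
  ∀ x : M, g x (T x) (T x) < 0

/-- The velocity of a curve `γ : [a,b] → M` at the parameter `s`. -/
def vel (γ : ℝ → M) (a b s : ℝ) : TangentSpace (𝓡 (n + 1)) (γ s) :=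
  mfderivWithin 𝓘(ℝ, ℝ) (𝓡 (n + 1)) γ (Set.Icc a b) s ((1 : ℝ) : TangentSpace 𝓘(ℝ, ℝ) s)

/-- `γ` is a future-directed causal curve on `[a,b]`. -/
def FutureCausalOn
    (g : ∀ x : M, TangentSpace (𝓡 (n + 1)) x → TangentSpace (𝓡 (n + 1)) x → ℝ)
    (T : ∀ x : M, TangentSpace (𝓡 (n + 1)) x) (γ : ℝ → M) (a b : ℝ) : Prop :=
  a ≤ b ∧ ContinuousOn γ (Set.Icc a b) ∧
    ∀ s ∈ Set.Icc a b,
      MDifferentiableWithinAt 𝓘(ℝ, ℝ) (𝓡 (n + 1)) γ (Set.Icc a b) s ∧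
      g (γ s) (vel γ a b s) (vel γ a b s) ≤ 0 ∧
      g (γ s) (T (γ s)) (vel γ a b s) < 0

/-- `γ` is a past-directed causal curve on `[a,b]`. -/
def PastCausalOn
    (g : ∀ x : M, TangentSpace (𝓡 (n + 1)) x → TangentSpace (𝓡 (n + 1)) x → ℝ)
    (T : ∀ x : M, TangentSpace (𝓡 (n + 1)) x) (γ : ℝ → M) (a b : ℝ) : Prop :=
  a ≤ b ∧ ContinuousOn γ (Set.Icc a b) ∧
    ∀ s ∈ Set.Icc a b,
      MDifferentiableWithinAt 𝓘(ℝ, ℝ) (𝓡 (n + 1)) γ (Set.Icc a b) s ∧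
      g (γ s) (vel γ a b s) (vel γ a b s) ≤ 0 ∧
      0 < g (γ s) (T (γ s)) (vel γ a b s)

/-- `p ≤ q`: `q` lies in the causal future of `p`. -/
def CausalLe
    (g : ∀ x : M, TangentSpace (𝓡 (n + 1)) x → TangentSpace (𝓡 (n + 1)) x → ℝ)
    (T : ∀ x : M, TangentSpace (𝓡 (n + 1)) x) (p q : M) : Prop :=
  p = q ∨ ∃ γ : ℝ → M, ∃ a b : ℝ, a < b ∧ FutureCausalOn g T γ a b ∧ γ a = p ∧ γ b = q

/-- A piecewise causal curve from `p` to `q`: a curve together with a partition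
`s 0 < s 1 < … < s k` such that on each piece it is either future-directed or
past-directed causal. -/
structure PiecewiseCausal
    (g : ∀ x : M, TangentSpace (𝓡 (n + 1)) x → TangentSpace (𝓡 (n + 1)) x → ℝ)
    (T : ∀ x : M, TangentSpace (𝓡 (n + 1)) x) (p q : M) where
  k : ℕ
  hk : 0 < k
  s : ℕ → ℝ
  hs : ∀ i < k, s i < s (i + 1)
  γ : ℝ → M
  h0 : γ (s 0) = p
  hlast : γ (s k) = q
  piece : ∀ i < k, FutureCausalOn g T γ (s i) (s (i + 1)) ∨
    PastCausalOn g T γ (s i) (s (i + 1))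

/-- The null length `L̂_τ(β) = ∑ |τ(β(sᵢ)) - τ(β(sᵢ₋₁))|`. -/
def nullLength (τ : M → ℝ)
    {g : ∀ x : M, TangentSpace (𝓡 (n + 1)) x → TangentSpace (𝓡 (n + 1)) x → ℝ}
    {T : ∀ x : M, TangentSpace (𝓡 (n + 1)) x} {p q : M}
    (β : PiecewiseCausal g T p q) : ℝ :=
  ∑ i ∈ Finset.range β.k, |τ (β.γ (β.s (i + 1))) - τ (β.γ (β.s i))|

/-- The null distance `d̂_τ(p,q)`. -/
def nullDist
    (g : ∀ x : M, TangentSpace (𝓡 (n + 1)) x → TangentSpace (𝓡 (n + 1)) x → ℝ)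
    (T : ∀ x : M, TangentSpace (𝓡 (n + 1)) x) (τ : M → ℝ) (p q : M) : ℝ :=
  sInf {L : ℝ | ∃ β : PiecewiseCausal g T p q, L = nullLength τ β}

/-- `τ` is a time function: continuous and strictly increasing along
future-directed causal curves. -/
def IsTimeFunction
    (g : ∀ x : M, TangentSpace (𝓡 (n + 1)) x → TangentSpace (𝓡 (n + 1)) x → ℝ)
    (T : ∀ x : M, TangentSpace (𝓡 (n + 1)) x) (τ : M → ℝ) : Prop :=
  Continuous τ ∧ ∀ (γ : ℝ → M) (a b : ℝ), a < b → FutureCausalOn g T γ a b →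
    τ (γ a) < τ (γ b)

/-- `τ` is locally anti-Lipschitz: every point has a neighbourhood `U` carrying
a distance function `d` which agrees with the manifold topology on `U` and
such that `p ≤ q` implies `τ(q) - τ(p) ≥ d(p,q)` for `p, q ∈ U`. -/
def LocallyAntiLipschitz
    (g : ∀ x : M, TangentSpace (𝓡 (n + 1)) x → TangentSpace (𝓡 (n + 1)) x → ℝ)
    (T : ∀ x : M, TangentSpace (𝓡 (n + 1)) x) (τ : M → ℝ) : Prop :=
  ∀ p : M, ∃ U ∈ 𝓝 p, ∃ d : M → M → ℝ,
    (∀ q ∈ U, ∀ r ∈ U, 0 ≤ d q r ∧ d q r = d r q ∧ (d q r = 0 ↔ q = r)) ∧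
    (∀ q ∈ U, ∀ r ∈ U, ∀ w ∈ U, d q w ≤ d q r + d r w) ∧
    (∀ q ∈ U, (𝓝[U] q).HasBasis (fun ε : ℝ => 0 < ε) (fun ε => {r ∈ U | d q r < ε})) ∧
    (∀ q ∈ U, ∀ r ∈ U, CausalLe g T q r → d q r ≤ τ r - τ q)

end SpacetimeNullDist

lemma mul_nonpos_iff_of_pos_left' {a b : ℝ} (h : 0 < a) : a * b ≤ 0 ↔ b ≤ 0 :=
  ⟨fun h' => by by_contra hb; nlinarith [mul_pos h (not_le.1 hb)],
    fun h' => mul_nonpos_of_nonneg_of_nonpos h.le h'⟩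

lemma mul_neg_iff_of_pos' {a b : ℝ} (h : 0 < a) : a * b < 0 ↔ b < 0 :=
  ⟨fun h' => by by_contra hb; nlinarith [mul_nonneg h.le (not_lt.1 hb)],
    fun h' => mul_neg_of_pos_of_neg h h'⟩

namespace SpacetimeNullDist

section helpers

variable {n : ℕ} {M : Type*} [TopologicalSpace M]
  [ChartedSpace (EuclideanSpace ℝ (Fin (n + 1))) M]
  {g : ∀ x : M, TangentSpace (𝓡 (n + 1)) x → TangentSpace (𝓡 (n + 1)) x → ℝ}
  {T : ∀ x : M, TangentSpace (𝓡 (n + 1)) x}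

/-- Signed causal curves: `σ = -1` is future directed, `σ = 1` is past directed. -/
def SCausal
    (g : ∀ x : M, TangentSpace (𝓡 (n + 1)) x → TangentSpace (𝓡 (n + 1)) x → ℝ)
    (T : ∀ x : M, TangentSpace (𝓡 (n + 1)) x) (σ : ℝ) (γ : ℝ → M) (a b : ℝ) : Prop :=
  a ≤ b ∧ ContinuousOn γ (Set.Icc a b) ∧
    ∀ s ∈ Set.Icc a b,
      MDifferentiableWithinAt 𝓘(ℝ, ℝ) (𝓡 (n + 1)) γ (Set.Icc a b) s ∧
      g (γ s) (vel γ a b s) (vel γ a b s) ≤ 0 ∧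
      0 < σ * g (γ s) (T (γ s)) (vel γ a b s)

lemma sCausal_neg_iff {γ : ℝ → M} {a b σ : ℝ} (hσ : σ < 0) :
    SCausal g T σ γ a b ↔ FutureCausalOn g T γ a b := by
  have h : ∀ x : ℝ, 0 < σ * x ↔ x < 0 := fun x =>
    ⟨fun h => by by_contra hx; nlinarith [not_lt.1 hx], fun h => mul_pos_of_neg_of_neg hσ h⟩
  simp only [SCausal, FutureCausalOn, h]

lemma sCausal_pos_iff {γ : ℝ → M} {a b σ : ℝ} (hσ : 0 < σ) :
    SCausal g T σ γ a b ↔ PastCausalOn g T γ a b := by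
  simp only [SCausal, PastCausalOn, mul_pos_iff_of_pos_left hσ]

lemma metric_congr {x y : M} (h : x = y) (u : TangentSpace (𝓡 (n + 1)) x)
    (v : TangentSpace (𝓡 (n + 1)) y)
    (huv : (show EuclideanSpace ℝ (Fin (n + 1)) from u) = v) :
    g x u u = g y v v ∧ g x (T x) u = g y (T y) v := by
  subst h
  have : u = v := huv
  subst this
  exact ⟨rfl, rfl⟩

lemma SCausal.congr {γ γ' : ℝ → M} {a b σ : ℝ} (h : SCausal g T σ γ a b)
    (heq : ∀ s ∈ Icc a b, γ' s = γ s) : SCausal g T σ γ' a b := by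
  refine ⟨h.1, h.2.1.congr heq, fun s hs => ?_⟩
  obtain ⟨h1, h2, h3⟩ := h.2.2 s hs
  have hv := metric_congr (g := g) (T := T) (heq s hs) (vel γ' a b s) (vel γ a b s) (by
    unfold vel
    have := mfderivWithin_congr_of_mem (I := 𝓘(ℝ, ℝ)) (I' := 𝓡 (n + 1)) heq hs
    exact congrArg (fun L : ℝ →L[ℝ] EuclideanSpace ℝ (Fin (n + 1)) => L 1) this)
  rw [hv.1, hv.2]
  exact ⟨h1.congr heq (heq s hs), h2, h3⟩

lemma SCausal.affine (hsymm : ∀ x u v, g x u v = g x v u) (hlin : ∀ x u, IsLinearMap ℝ (g x u))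
    {γ : ℝ → M} {a b σ m c a' b' : ℝ} (h : SCausal g T σ γ a b)
    (hm : m ≠ 0) (hab' : a' < b') (hmaps : ∀ s ∈ Icc a' b', m * s + c ∈ Icc a b) :
    SCausal g T (σ * m) (fun s => γ (m * s + c)) a' b' := by
  have hd : ∀ s, HasDerivWithinAt (fun s : ℝ => m * s + c) m (Icc a' b') s := fun s => by
    simpa using (((hasDerivAt_id s).const_mul m).add_const c).hasDerivWithinAt
  refine ⟨hab'.le, h.2.1.comp (by fun_prop) hmaps, fun s hs => ?_⟩
  obtain ⟨h1, h2, h3⟩ := h.2.2 _ (hmaps s hs)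
  have hmd : MDifferentiableWithinAt 𝓘(ℝ, ℝ) 𝓘(ℝ, ℝ) (fun s : ℝ => m * s + c) (Icc a' b') s :=
    (hd s).differentiableWithinAt.mdifferentiableWithinAt
  have hu : UniqueDiffWithinAt ℝ (Icc a' b') s := uniqueDiffOn_Icc hab' s hs
  have hv : vel (fun s => γ (m * s + c)) a' b' s
      = (m • vel γ a b (m * s + c) : TangentSpace (𝓡 (n + 1)) (γ (m * s + c))) := by
    unfold vel
    have key := mfderivWithin_comp (I := 𝓘(ℝ, ℝ)) (I' := 𝓘(ℝ, ℝ)) (I'' := 𝓡 (n + 1)) s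
      (g := γ) (f := fun s : ℝ => m * s + c) (u := Icc a b) h1 hmd hmaps
      hu.uniqueMDiffWithinAt
    have e1 : fderivWithin ℝ (fun s : ℝ => m * s + c) (Icc a' b') s 1 = m := by
      have := (hd s).derivWithin hu
      rwa [← fderivWithin_derivWithin] at this
    rw [mfderivWithin_eq_fderivWithin] at key
    have e2 : ∀ (A : ℝ →L[ℝ] EuclideanSpace ℝ (Fin (n + 1))) (B : ℝ →L[ℝ] ℝ), B 1 = m →
        (A.comp B) 1 = m • A 1 := by
      intro A B hB
      rw [ContinuousLinearMap.comp_apply, hB, ← A.map_smul, smul_eq_mul, mul_one]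
    exact (congrArg (fun L : ℝ →L[ℝ] EuclideanSpace ℝ (Fin (n + 1)) => L 1) key).trans
      (e2 _ _ e1)
  refine ⟨MDifferentiableWithinAt.comp (u := Icc a b) (g := γ) s h1 hmd hmaps, ?_, ?_⟩
  · rw [hv, (hlin _ _).map_smul, hsymm, (hlin _ _).map_smul, smul_eq_mul, smul_eq_mul, ← mul_assoc]
    exact mul_nonpos_of_nonneg_of_nonpos (mul_self_nonneg m) h2
  · rw [hv, (hlin _ _).map_smul, smul_eq_mul]
    have : 0 < m * m := mul_self_pos.2 hm
    calc 0 < (m * m) * (σ * g (γ (m * s + c)) (T (γ (m * s + c))) (vel γ a b (m * s + c))) :=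
          mul_pos this h3
      _ = _ := by ring

/-- one future-directed causal step -/
def FStep (g : ∀ x : M, TangentSpace (𝓡 (n + 1)) x → TangentSpace (𝓡 (n + 1)) x → ℝ)
    (T : ∀ x : M, TangentSpace (𝓡 (n + 1)) x) (p q : M) : Prop :=
  ∃ γ : ℝ → M, ∃ a b : ℝ, a < b ∧ FutureCausalOn g T γ a b ∧ γ a = p ∧ γ b = q

lemma fStep_of_past (hsymm : ∀ x u v, g x u v = g x v u) (hlin : ∀ x u, IsLinearMap ℝ (g x u))
    {γ : ℝ → M} {a b : ℝ} (hab : a < b) (h : PastCausalOn g T γ a b) :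
    FutureCausalOn g T (fun s => γ (-1 * s + 0)) (-b) (-a) := by
  have := ((sCausal_pos_iff (σ := 1) one_pos).2 h).affine hsymm hlin (m := -1) (c := 0)
    (a' := -b) (b' := -a) (by norm_num) (by linarith)
    (fun s hs => ⟨by linarith [hs.2], by linarith [hs.1]⟩)
  exact (sCausal_neg_iff (by norm_num)).1 this

lemma past_of_future (hsymm : ∀ x u v, g x u v = g x v u) (hlin : ∀ x u, IsLinearMap ℝ (g x u))
    {γ : ℝ → M} {a b : ℝ} (hab : a < b) (h : FutureCausalOn g T γ a b) :
    PastCausalOn g T (fun s => γ (-1 * s + 0)) (-b) (-a) := by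
  have := ((sCausal_neg_iff (σ := -1) (by norm_num)).2 h).affine hsymm hlin (m := -1) (c := 0)
    (a' := -b) (b' := -a) (by norm_num) (by linarith)
    (fun s hs => ⟨by linarith [hs.2], by linarith [hs.1]⟩)
  exact (sCausal_pos_iff (by norm_num)).1 this

/-- chains of causal steps together with their null length -/
inductive Reach (g : ∀ x : M, TangentSpace (𝓡 (n + 1)) x → TangentSpace (𝓡 (n + 1)) x → ℝ)
    (T : ∀ x : M, TangentSpace (𝓡 (n + 1)) x) (τ : M → ℝ) (p : M) : M → ℝ → Prop
  | single {q : M} : (FStep g T p q ∨ FStep g T q p) → Reach g T τ p q |τ q - τ p|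
  | tail {q r : M} {L : ℝ} : Reach g T τ p q L → (FStep g T q r ∨ FStep g T r q) →
      Reach g T τ p r (L + |τ r - τ q|)

lemma reach_of_partition (hsymm : ∀ x u v, g x u v = g x v u)
    (hlin : ∀ x u, IsLinearMap ℝ (g x u)) (τ : M → ℝ) (γ : ℝ → M) (s : ℕ → ℝ) (k : ℕ)
    (hs : ∀ i < k + 1, s i < s (i + 1))
    (hp : ∀ i < k + 1, FutureCausalOn g T γ (s i) (s (i + 1)) ∨
      PastCausalOn g T γ (s i) (s (i + 1))) :
    Reach g T τ (γ (s 0)) (γ (s (k + 1)))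
      (∑ i ∈ Finset.range (k + 1), |τ (γ (s (i + 1))) - τ (γ (s i))|) := by
  have step : ∀ i < k + 1, FStep g T (γ (s i)) (γ (s (i + 1))) ∨
      FStep g T (γ (s (i + 1))) (γ (s i)) := by
    intro i hi
    rcases hp i hi with h | h
    · exact Or.inl ⟨γ, _, _, hs i hi, h, rfl, rfl⟩
    · exact Or.inr ⟨_, _, _, by linarith [hs i hi], fStep_of_past hsymm hlin (hs i hi) h,
        by simp, by simp⟩
  clear hp hs
  induction k with
  | zero => simpa using Reach.single (τ := τ) (step 0 (by omega))
  | succ k ih =>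
    rw [Finset.sum_range_succ]
    exact Reach.tail (ih fun i hi => step i (by omega)) (step (k + 1) (by omega))

lemma exists_piece (hsymm : ∀ x u v, g x u v = g x v u)
    (hlin : ∀ x u, IsLinearMap ℝ (g x u)) {p q : M} (h : FStep g T p q ∨ FStep g T q p) (a : ℝ) :
    ∃ (γ : ℝ → M) (b σ : ℝ), a < b ∧ σ ≠ 0 ∧ SCausal g T σ γ a b ∧ γ a = p ∧ γ b = q := by
  obtain ⟨γ, a', b', σ, hab, hσ, hc, h1, h2⟩ : ∃ (γ : ℝ → M) (a b σ : ℝ), a < b ∧ σ ≠ 0 ∧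
      SCausal g T σ γ a b ∧ γ a = p ∧ γ b = q := by
    rcases h with ⟨γ, a, b, hab, hf, h1, h2⟩ | ⟨γ, a, b, hab, hf, h1, h2⟩
    · exact ⟨γ, a, b, -1, hab, by norm_num, (sCausal_neg_iff (by norm_num)).2 hf, h1, h2⟩
    · exact ⟨_, -b, -a, 1, by linarith, by norm_num,
        (sCausal_pos_iff (by norm_num)).2 (past_of_future hsymm hlin hab hf), by simpa using h2,
        by simpa using h1⟩
  refine ⟨_, a + (b' - a'), σ * 1, by linarith, by simpa using hσ,
    hc.affine hsymm hlin (m := 1) (c := a' - a) (a' := a) (b' := a + (b' - a')) one_ne_zero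
      (by linarith) (fun s hs => ⟨by linarith [hs.1], by linarith [hs.2]⟩), ?_, ?_⟩
  · simp [h1]
  · rw [← h2]; congr 1; ring

lemma SCausal.or {γ : ℝ → M} {a b σ : ℝ} (hσ : σ ≠ 0) (h : SCausal g T σ γ a b) :
    FutureCausalOn g T γ a b ∨ PastCausalOn g T γ a b := by
  rcases lt_or_gt_of_ne hσ with h' | h'
  · exact Or.inl ((sCausal_neg_iff h').1 h)
  · exact Or.inr ((sCausal_pos_iff h').1 h)

lemma or_congr' {γ γ' : ℝ → M} {a b : ℝ}
    (h : FutureCausalOn g T γ a b ∨ PastCausalOn g T γ a b)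
    (heq : ∀ s ∈ Icc a b, γ' s = γ s) :
    FutureCausalOn g T γ' a b ∨ PastCausalOn g T γ' a b := by
  rcases h with h | h
  · exact (((sCausal_neg_iff (σ := -1) (by norm_num)).2 h).congr heq).or (by norm_num)
  · exact (((sCausal_pos_iff (σ := 1) (by norm_num)).2 h).congr heq).or (by norm_num)

lemma pw_mono {s : ℕ → ℝ} {k : ℕ} (hs : ∀ i < k, s i < s (i + 1)) :
    ∀ i ≤ k, s i ≤ s k := by
  induction k with
  | zero => intro i hi; obtain rfl : i = 0 := by omega
            exact le_rfl
  | succ k ih =>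
    intro i hi
    rcases Nat.lt_or_ge k i with h | h
    · obtain rfl : i = k + 1 := by omega
      exact le_rfl
    · exact (ih (fun j hj => hs j (by omega)) i h).trans (hs k (by omega)).le

lemma reach_iff (hsymm : ∀ x u v, g x u v = g x v u)
    (hlin : ∀ x u, IsLinearMap ℝ (g x u)) (τ : M → ℝ) (p q : M) (L : ℝ) :
    (∃ β : PiecewiseCausal g T p q, L = nullLength τ β) ↔ Reach g T τ p q L := by
  constructor
  · rintro ⟨⟨k, hk, s, hs, γ, h0, hl, hp⟩, rfl⟩
    obtain ⟨k, rfl⟩ : ∃ j, k = j + 1 := ⟨k - 1, by omega⟩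
    subst h0 hl
    exact reach_of_partition hsymm hlin τ γ s k hs hp
  · intro h
    induction h with
    | single h =>
      obtain ⟨γ, b, σ, hab, hσ, hc, h1, h2⟩ := exists_piece hsymm hlin h 0
      refine ⟨⟨1, one_pos, fun i => if i = 0 then 0 else b, ?_, γ, ?_, ?_, ?_⟩, ?_⟩
      · intro i hi
        obtain rfl : i = 0 := by omega
        simpa using hab
      · simpa using h1
      · simpa using h2
      · intro i hi
        obtain rfl : i = 0 := by omega
        simpa using hc.or hσ
      · simp [nullLength, h1, h2]
    | @tail q r L _ h ih =>
      obtain ⟨⟨k, hk, s, hs, γ, h0, hl, hp⟩, rfl⟩ := ih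
      obtain ⟨γ', b, σ, hab, hσ, hc, h1, h2⟩ := exists_piece hsymm hlin h (s k)
      have hmono := pw_mono hs
      set Γ : ℝ → M := fun t => if t ≤ s k then γ t else γ' t with hΓ
      set S : ℕ → ℝ := fun i => if i ≤ k then s i else b with hS
      have hSl : ∀ i ≤ k, S i = s i := fun i hi => by simp [hS, hi]
      have hSk : S (k + 1) = b := by simp [hS]
      have hΓl : ∀ t ≤ s k, Γ t = γ t := fun t ht => by simp [hΓ, ht]
      have hΓr : ∀ t, s k ≤ t → Γ t = γ' t := fun t ht => by
        rcases ht.eq_or_lt with rfl | h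
        · simp [hΓ, hl, h1]
        · simp [hΓ, not_le.2 h]
      refine ⟨⟨k + 1, by omega, S, ?_, Γ, ?_, ?_, ?_⟩, ?_⟩
      · intro i hi
        rcases Nat.lt_or_ge i k with h | h
        · rw [hSl i h.le, hSl (i + 1) h]; exact hs i h
        · obtain rfl : i = k := by omega
          rw [hSl i le_rfl, hSk]; exact hab
      · rw [hSl 0 (by omega), hΓl _ (hmono 0 (by omega)), h0]
      · rw [hSk, hΓr _ hab.le, h2]
      · intro i hi
        rcases Nat.lt_or_ge i k with h | h
        · rw [hSl i h.le, hSl (i + 1) h]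
          exact or_congr' (hp i h) fun t ht => hΓl t (ht.2.trans (hmono _ h))
        · obtain rfl : i = k := by omega
          rw [hSl i le_rfl, hSk]
          exact or_congr' (hc.or hσ) fun t ht => hΓr t ht.1
      · simp only [nullLength]
        rw [Finset.sum_range_succ, hSk, hSl k le_rfl, hΓr _ hab.le, hΓr _ le_rfl, h1, h2]
        congr 1
        refine Finset.sum_congr rfl fun i hi => ?_
        have hi := Finset.mem_range.1 hi
        rw [hSl i hi.le, hSl (i + 1) hi, hΓl _ (hmono _ hi.le), hΓl _ (hmono _ hi)]

lemma Reach.nonneg {τ : M → ℝ} {p q : M} {L : ℝ} (h : Reach g T τ p q L) : 0 ≤ L := by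
  induction h with
  | single _ => positivity
  | tail _ _ ih => positivity

lemma Reach.trans {τ : M → ℝ} {p q r : M} {L L' : ℝ} (h : Reach g T τ p q L)
    (h' : Reach g T τ q r L') : Reach g T τ p r (L + L') := by
  induction h' with
  | single h1 => exact h.tail h1
  | tail _ h1 ih => rw [← add_assoc]; exact ih.tail h1

lemma Reach.symm {τ : M → ℝ} {p q : M} {L : ℝ} (h : Reach g T τ p q L) :
    Reach g T τ q p L := by
  induction h with
  | single h1 => rw [abs_sub_comm]; exact .single h1.symm
  | tail _ h1 ih =>
    rw [add_comm, abs_sub_comm]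
    exact (Reach.single h1.symm).trans ih

lemma FutureCausalOn.mono (hsymm : ∀ x u v, g x u v = g x v u)
    (hlin : ∀ x u, IsLinearMap ℝ (g x u)) {γ : ℝ → M} {a b a' b' : ℝ}
    (h : FutureCausalOn g T γ a b) (ha : a ≤ a') (hab : a' < b') (hb : b' ≤ b) :
    FutureCausalOn g T γ a' b' := by
  have := ((sCausal_neg_iff (σ := -1) (by norm_num)).2 h).affine hsymm hlin (m := 1) (c := 0)
    (a' := a') (b' := b') (by norm_num) hab
    (fun s hs => ⟨by linarith [hs.1], by linarith [hs.2]⟩)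
  simpa using (sCausal_neg_iff (by norm_num)).1 this

/-- A continuous curve that starts in `K`, and can only be in `U` when it is in the
interior of the closed set `K ⊆ U`, stays in `K`. -/
lemma stays {γ : ℝ → M} {a b : ℝ} (hab : a ≤ b) (hc : ContinuousOn γ (Icc a b)) {K U : Set M}
    (hK : IsClosed K) (hKU : K ⊆ U) (c : ℝ) (hcI : c ∈ Icc a b) (h0 : γ c ∈ U)
    (hW : ∀ t ∈ Icc a b, γ t ∈ U → γ t ∈ interior K) : ∀ t ∈ Icc a b, γ t ∈ interior K := by
  have := isPreconnected_Icc.image γ hc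
  have hsub : γ '' Icc a b ⊆ interior K := by
    refine this.subset_left_of_subset_union isOpen_interior hK.isOpen_compl ?_ ?_ ?_
    · exact disjoint_compl_right.mono_left interior_subset
    · rintro _ ⟨t, ht, rfl⟩
      by_cases h : γ t ∈ K
      · exact Or.inl (hW t ht (hKU h))
      · exact Or.inr h
    · exact ⟨γ c, ⟨c, hcI, rfl⟩, hW c hcI h0⟩
  exact fun t ht => hsub ⟨t, ht, rfl⟩

lemma fstep_control (hsymm : ∀ x u v, g x u v = g x v u)
    (hlin : ∀ x u, IsLinearMap ℝ (g x u)) {τ : M → ℝ} (hτ : IsTimeFunction g T τ)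
    {U K : Set M} {d : M → M → ℝ} {p : M} (hpU : p ∈ U)
    (hd : ∀ q ∈ U, ∀ r ∈ U, 0 ≤ d q r ∧ d q r = d r q ∧ (d q r = 0 ↔ q = r))
    (htri : ∀ q ∈ U, ∀ r ∈ U, ∀ w ∈ U, d q w ≤ d q r + d r w)
    (hal : ∀ q ∈ U, ∀ r ∈ U, CausalLe g T q r → d q r ≤ τ r - τ q)
    (hK : IsClosed K) (hKU : K ⊆ U) {ε : ℝ}
    (hW : {r ∈ U | d p r < ε} ⊆ interior K) {x y : M} {L : ℝ}
    (hx : x ∈ U) (hL : d p x ≤ L) (hxy : FStep g T x y ∨ FStep g T y x)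
    (hlt : L + |τ y - τ x| < ε) : y ∈ U ∧ d p y ≤ L + |τ y - τ x| := by
  suffices hy : y ∈ U by
    refine ⟨hy, (htri p hpU x hx y hy).trans (add_le_add hL ?_)⟩
    rcases hxy with h | h
    · exact (hal x hx y hy (Or.inr h)).trans (le_abs_self _)
    · rw [(hd x hx y hy).2.1, abs_sub_comm]
      exact (hal y hy x hx (Or.inr h)).trans (le_abs_self _)
  have hmono : ∀ {γ : ℝ → M} {a b : ℝ}, FutureCausalOn g T γ a b → ∀ s ∈ Icc a b, ∀ t ∈ Icc a b,
      s ≤ t → CausalLe g T (γ s) (γ t) ∧ τ (γ s) ≤ τ (γ t) := by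
    intro γ a b h s hs t ht hst
    rcases hst.eq_or_lt with rfl | hlt
    · exact ⟨Or.inl rfl, le_rfl⟩
    · have h' := FutureCausalOn.mono hsymm hlin h hs.1 hlt ht.2
      exact ⟨Or.inr ⟨γ, s, t, hlt, h', rfl, rfl⟩, (hτ.2 γ s t hlt h').le⟩
  rcases hxy with ⟨γ, a, b, hab, hf, rfl, rfl⟩ | ⟨γ, a, b, hab, hf, rfl, rfl⟩
  · have ha : a ∈ Icc a b := ⟨le_rfl, hab.le⟩
    have hb : b ∈ Icc a b := ⟨hab.le, le_rfl⟩
    refine hKU (interior_subset (stays hab.le hf.2.1 hK hKU a ha hx ?_ b hb))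
    intro t ht htU
    refine hW ⟨htU, ?_⟩
    have h1 := htri p hpU _ hx _ htU
    have h2 := hal _ hx _ htU (hmono hf a ha t ht ht.1).1
    have h3 := (hmono hf t ht b hb ht.2).2
    have h4 := le_abs_self (τ (γ b) - τ (γ a))
    linarith
  · have ha : a ∈ Icc a b := ⟨le_rfl, hab.le⟩
    have hb : b ∈ Icc a b := ⟨hab.le, le_rfl⟩
    refine hKU (interior_subset (stays hab.le hf.2.1 hK hKU b hb hx ?_ a ha))
    intro t ht htU
    refine hW ⟨htU, ?_⟩
    have h1 := htri p hpU _ hx _ htU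
    have h2 := hal _ htU _ hx (hmono hf t ht b hb ht.2).1
    rw [(hd _ htU _ hx).2.1] at h2
    have h3 := (hmono hf a ha t ht ht.1).2
    have h4 := neg_abs_le (τ (γ a) - τ (γ b))
    linarith

lemma reach_control (hsymm : ∀ x u v, g x u v = g x v u)
    (hlin : ∀ x u, IsLinearMap ℝ (g x u)) {τ : M → ℝ} (hτ : IsTimeFunction g T τ)
    {U K : Set M} {d : M → M → ℝ} {p : M} (hpU : p ∈ U)
    (hd : ∀ q ∈ U, ∀ r ∈ U, 0 ≤ d q r ∧ d q r = d r q ∧ (d q r = 0 ↔ q = r))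
    (htri : ∀ q ∈ U, ∀ r ∈ U, ∀ w ∈ U, d q w ≤ d q r + d r w)
    (hal : ∀ q ∈ U, ∀ r ∈ U, CausalLe g T q r → d q r ≤ τ r - τ q)
    (hK : IsClosed K) (hKU : K ⊆ U) {ε : ℝ}
    (hW : {r ∈ U | d p r < ε} ⊆ interior K) {q : M} {L : ℝ}
    (h : Reach g T τ p q L) (hL : L < ε) : q ∈ U ∧ d p q ≤ L := by
  induction h with
  | single h1 =>
    have := fstep_control hsymm hlin hτ hpU hd htri hal hK hKU hW hpU (L := 0)
      ((hd p hpU p hpU).2.2.2 rfl).le h1 (by simpa using hL)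
    simpa using this
  | @tail q r L h h1 ih =>
    have hq := ih (by linarith [abs_nonneg (τ r - τ q)])
    exact fstep_control hsymm hlin hτ hpU hd htri hal hK hKU hW hq.1 hq.2 h1 hL

end helpers

end SpacetimeNullDist
namespace SpacetimeNullDist

section helpers2

variable {n : ℕ} {M : Type*} [TopologicalSpace M]
  [ChartedSpace (EuclideanSpace ℝ (Fin (n + 1))) M]
  [IsManifold (𝓡 (n + 1)) (⊤ : ℕ∞) M]
  {g : ∀ x : M, TangentSpace (𝓡 (n + 1)) x → TangentSpace (𝓡 (n + 1)) x → ℝ}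
  {T : ∀ x : M, TangentSpace (𝓡 (n + 1)) x}

/-- derivative of the inverse chart -/
def cD (p : M) (y : EuclideanSpace ℝ (Fin (n + 1))) (w : EuclideanSpace ℝ (Fin (n + 1))) :
    TangentSpace (𝓡 (n + 1)) ((extChartAt (𝓡 (n + 1)) p).symm y) :=
  mfderivWithin 𝓘(ℝ, EuclideanSpace ℝ (Fin (n + 1))) (𝓡 (n + 1))
    (extChartAt (𝓡 (n + 1)) p).symm (extChartAt (𝓡 (n + 1)) p).target y w

lemma cD_add (p : M) (y u w : EuclideanSpace ℝ (Fin (n + 1))) :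
    cD p y (u + w) = cD p y u + cD p y w :=
  (mfderivWithin 𝓘(ℝ, EuclideanSpace ℝ (Fin (n + 1))) (𝓡 (n + 1))
    (extChartAt (𝓡 (n + 1)) p).symm (extChartAt (𝓡 (n + 1)) p).target y).map_add u w

lemma quad_cont (hg : IsLorentzMetric g) (p : M) :
    ContinuousOn (fun z : EuclideanSpace ℝ (Fin (n + 1)) × EuclideanSpace ℝ (Fin (n + 1)) =>
      g ((extChartAt (𝓡 (n + 1)) p).symm z.1) (cD p z.1 z.2) (cD p z.1 z.2))
      ((extChartAt (𝓡 (n + 1)) p).target ×ˢ univ) := by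
  have h1 := (contMDiffOn_extChartAt_symm (I := 𝓡 (n + 1)) (n := (⊤ : ℕ∞)) p)
  have h2 := h1.continuousOn_tangentMapWithin (by simp)
    (isOpen_extChartAt_target p).uniqueMDiffOn
  have h3 : Continuous (fun z : EuclideanSpace ℝ (Fin (n + 1)) × EuclideanSpace ℝ (Fin (n + 1)) =>
      (⟨z.1, z.2⟩ : TangentBundle 𝓘(ℝ, EuclideanSpace ℝ (Fin (n + 1)))
        (EuclideanSpace ℝ (Fin (n + 1))))) :=
    (tangentBundleModelSpaceHomeomorph 𝓘(ℝ, EuclideanSpace ℝ (Fin (n + 1)))).symm.continuous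
  have h4 := hg.2.2.2.continuous.comp_continuousOn
    (h2.comp h3.continuousOn (s := (extChartAt (𝓡 (n + 1)) p).target ×ˢ univ)
      (fun z hz => hz.1))
  exact h4

/-- the time orientation in the chart -/
def cT (T : ∀ x : M, TangentSpace (𝓡 (n + 1)) x) (p : M)
    (y : EuclideanSpace ℝ (Fin (n + 1))) : EuclideanSpace ℝ (Fin (n + 1)) :=
  mfderivWithin (𝓡 (n + 1)) 𝓘(ℝ, EuclideanSpace ℝ (Fin (n + 1)))
    (extChartAt (𝓡 (n + 1)) p) (extChartAt (𝓡 (n + 1)) p).source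
    ((extChartAt (𝓡 (n + 1)) p).symm y) (T ((extChartAt (𝓡 (n + 1)) p).symm y))

lemma cT_cont (hT : IsTimeOrientation g T) (p : M) :
    ContinuousOn (cT T p) (extChartAt (𝓡 (n + 1)) p).target := by
  have h1 := (contMDiffOn_extChartAt (I := 𝓡 (n + 1)) (n := (⊤ : ℕ∞)) (x := p))
  rw [← extChartAt_source (𝓡 (n + 1))] at h1
  have h2 := h1.continuousOn_tangentMapWithin (by simp)
    (isOpen_extChartAt_source p).uniqueMDiffOn
  have h3 := hT.1.comp_continuousOn (continuousOn_extChartAt_symm (I := 𝓡 (n + 1)) p)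
  have h4 := h2.comp h3 (fun y hy => (extChartAt (𝓡 (n + 1)) p).map_target hy)
  have h5 := (tangentBundleModelSpaceHomeomorph
    𝓘(ℝ, EuclideanSpace ℝ (Fin (n + 1)))).continuous.comp_continuousOn h4
  exact continuous_snd.comp_continuousOn h5

lemma cD_cT (p : M) {y : EuclideanSpace ℝ (Fin (n + 1))}
    (hy : y ∈ (extChartAt (𝓡 (n + 1)) p).target) :
    cD p y (cT T p y) = T ((extChartAt (𝓡 (n + 1)) p).symm y) := by
  have := mfderivWithin_extChartAt_symm_comp_mfderiv_extChartAt
    (I := 𝓡 (n + 1)) (x := p) hy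
  have hs := (extChartAt (𝓡 (n + 1)) p).map_target hy
  unfold cD cT
  rw [mfderivWithin_of_isOpen (isOpen_extChartAt_source p) hs,
    mfderivWithin_of_isOpen (isOpen_extChartAt_target p) hy]
  rw [ModelWithCorners.range_eq_univ, mfderivWithin_univ] at this
  exact congrArg (fun L : EuclideanSpace ℝ (Fin (n + 1)) →L[ℝ] EuclideanSpace ℝ (Fin (n + 1)) =>
    L (T ((extChartAt (𝓡 (n + 1)) p).symm y))) this

lemma cone_nhds (hg : IsLorentzMetric g) (hT : IsTimeOrientation g T) (p : M) :
    ∃ r > 0, ∀ y ∈ Metric.ball (extChartAt (𝓡 (n + 1)) p p) r,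
      ∀ w ∈ Metric.ball (cT T p (extChartAt (𝓡 (n + 1)) p p)) r,
      y ∈ (extChartAt (𝓡 (n + 1)) p).target ∧
      g ((extChartAt (𝓡 (n + 1)) p).symm y) (cD p y w) (cD p y w) ≤ 0 ∧
      g ((extChartAt (𝓡 (n + 1)) p).symm y) (T ((extChartAt (𝓡 (n + 1)) p).symm y))
        (cD p y w) < 0 := by
  obtain ⟨hsymm, hlin, -, -⟩ := id hg
  set φ := extChartAt (𝓡 (n + 1)) p with hφ
  set y0 := φ p with hy0
  set w0 := cT T p y0 with hw0
  have hy0t : y0 ∈ φ.target := mem_extChartAt_target p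
  have hopen : IsOpen φ.target := isOpen_extChartAt_target p
  have hQ := quad_cont hg p
  have htn : ∀ w, (φ.target ×ˢ univ : Set (EuclideanSpace ℝ (Fin (n + 1)) ×
      EuclideanSpace ℝ (Fin (n + 1)))) ∈ 𝓝 (y0, w) := fun w =>
    (hopen.prod isOpen_univ).mem_nhds ⟨hy0t, mem_univ _⟩
  have hQat : ∀ w, ContinuousAt (fun z : EuclideanSpace ℝ (Fin (n + 1)) ×
      EuclideanSpace ℝ (Fin (n + 1)) => g (φ.symm z.1) (cD p z.1 z.2) (cD p z.1 z.2)) (y0, w) :=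
    fun w => hQ.continuousAt (htn w)
  have hcT : ContinuousAt (cT T p) y0 := (cT_cont hT p).continuousAt (hopen.mem_nhds hy0t)
  have hcT' : ContinuousAt (fun z : EuclideanSpace ℝ (Fin (n + 1)) ×
      EuclideanSpace ℝ (Fin (n + 1)) => cT T p z.1) (y0, w0) :=
    ContinuousAt.comp (f := Prod.fst) (x := (y0, w0)) hcT continuousAt_fst
  have hA : ContinuousAt (fun z : EuclideanSpace ℝ (Fin (n + 1)) ×
      EuclideanSpace ℝ (Fin (n + 1)) => g (φ.symm z.1) (cD p z.1 (cT T p z.1 + z.2))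
        (cD p z.1 (cT T p z.1 + z.2))) (y0, w0) :=
    ContinuousAt.comp (f := fun z : EuclideanSpace ℝ (Fin (n + 1)) ×
      EuclideanSpace ℝ (Fin (n + 1)) => (z.1, cT T p z.1 + z.2)) (x := (y0, w0))
      (hQat _) (continuousAt_fst.prodMk (hcT'.add continuousAt_snd))
  have hB : ContinuousAt (fun z : EuclideanSpace ℝ (Fin (n + 1)) ×
      EuclideanSpace ℝ (Fin (n + 1)) => g (φ.symm z.1) (cD p z.1 (cT T p z.1))
        (cD p z.1 (cT T p z.1))) (y0, w0) :=
    ContinuousAt.comp (f := fun z : EuclideanSpace ℝ (Fin (n + 1)) ×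
      EuclideanSpace ℝ (Fin (n + 1)) => (z.1, cT T p z.1)) (x := (y0, w0))
      (hQat _) (continuousAt_fst.prodMk hcT')
  have hpol : ∀ y u w : EuclideanSpace ℝ (Fin (n + 1)),
      g (φ.symm y) (cD p y (u + w)) (cD p y (u + w)) - g (φ.symm y) (cD p y u) (cD p y u)
        - g (φ.symm y) (cD p y w) (cD p y w) = 2 * g (φ.symm y) (cD p y u) (cD p y w) := by
    intro y u w
    rw [cD_add, (hlin _ _).map_add, hsymm _ _ (cD p y u), hsymm _ _ (cD p y w),
      (hlin _ _).map_add, (hlin _ _).map_add, hsymm _ (cD p y w) (cD p y u)]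
    ring
  have hC : ContinuousAt (fun z : EuclideanSpace ℝ (Fin (n + 1)) ×
      EuclideanSpace ℝ (Fin (n + 1)) => 2 * g (φ.symm z.1) (cD p z.1 (cT T p z.1))
        (cD p z.1 z.2)) (y0, w0) := by
    refine ((hA.sub hB).sub (hQat w0)).congr (Eventually.of_forall fun z => ?_)
    exact hpol _ _ _
  have hTp : g (φ.symm y0) (cD p y0 w0) (cD p y0 w0) < 0 := by
    rw [hw0, cD_cT p hy0t]; exact hT.2 _
  have e1 := (hQat w0).eventually (gt_mem_nhds hTp)
  have e2 := hC.eventually (gt_mem_nhds (show 2 * g (φ.symm y0) (cD p y0 (cT T p y0))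
    (cD p y0 w0) < 0 by rw [← hw0]; linarith))
  have e0 : ∀ᶠ z in 𝓝 (y0, w0), z ∈ φ.target ×ˢ univ := htn w0
  obtain ⟨r, hr, hball⟩ := Metric.eventually_nhds_iff_ball.1 (Filter.Eventually.and e0
    (Filter.Eventually.and e1 e2))
  refine ⟨r, hr, fun y hy w hw => ?_⟩
  obtain ⟨h1, h2, h3⟩ := hball (y, w) (by
    rw [← ball_prod_same]; exact ⟨hy, hw⟩)
  refine ⟨h1.1, h2.le, ?_⟩
  have h3 : 2 * g (φ.symm y) (cD p y (cT T p y)) (cD p y w) < 0 := h3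
  rw [cD_cT p h1.1] at h3
  linarith

lemma line_step (p : M) {y w : EuclideanSpace ℝ (Fin (n + 1))} {l : ℝ} (hl : 0 < l)
    (h : ∀ s ∈ Icc 0 l, y + s • w ∈ (extChartAt (𝓡 (n + 1)) p).target ∧
      g ((extChartAt (𝓡 (n + 1)) p).symm (y + s • w)) (cD p (y + s • w) w)
        (cD p (y + s • w) w) ≤ 0 ∧
      g ((extChartAt (𝓡 (n + 1)) p).symm (y + s • w))
        (T ((extChartAt (𝓡 (n + 1)) p).symm (y + s • w))) (cD p (y + s • w) w) < 0) :
    FStep g T ((extChartAt (𝓡 (n + 1)) p).symm y)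
      ((extChartAt (𝓡 (n + 1)) p).symm (y + l • w)) := by
  refine ⟨fun s => (extChartAt (𝓡 (n + 1)) p).symm (y + s • w), 0, l, hl,
    ⟨hl.le, ?_, fun s hs => ?_⟩, by simp, rfl⟩
  · exact (continuousOn_extChartAt_symm (I := 𝓡 (n + 1)) p).comp
      (by fun_prop : Continuous fun s : ℝ => y + s • w).continuousOn (fun s hs => (h s hs).1)
  obtain ⟨h1, h2, h3⟩ := h s hs
  have hd : HasDerivWithinAt (fun s : ℝ => y + s • w) w (Icc 0 l) s := by
    simpa using (((hasDerivAt_id s).smul_const w).const_add y).hasDerivWithinAt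
  have hmd : MDifferentiableWithinAt 𝓘(ℝ, ℝ) 𝓘(ℝ, EuclideanSpace ℝ (Fin (n + 1)))
      (fun s : ℝ => y + s • w) (Icc 0 l) s :=
    hd.differentiableWithinAt.mdifferentiableWithinAt
  have hmd' := mdifferentiableOn_extChartAt_symm (I := 𝓡 (n + 1)) (x := p) _ h1
  have hu : UniqueDiffWithinAt ℝ (Icc 0 l) s := uniqueDiffOn_Icc hl s hs
  have hmaps : Icc 0 l ⊆ (fun s : ℝ => y + s • w) ⁻¹' (extChartAt (𝓡 (n + 1)) p).target :=
    fun s hs => (h s hs).1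
  have hv : vel (fun s => (extChartAt (𝓡 (n + 1)) p).symm (y + s • w)) 0 l s
      = cD p (y + s • w) w := by
    have key := mfderivWithin_comp (I := 𝓘(ℝ, ℝ))
      (I' := 𝓘(ℝ, EuclideanSpace ℝ (Fin (n + 1)))) (I'' := 𝓡 (n + 1)) s
      (g := (extChartAt (𝓡 (n + 1)) p).symm) (f := fun s : ℝ => y + s • w)
      (u := (extChartAt (𝓡 (n + 1)) p).target) hmd' hmd hmaps hu.uniqueMDiffWithinAt
    rw [mfderivWithin_eq_fderivWithin] at key
    have e1 : fderivWithin ℝ (fun s : ℝ => y + s • w) (Icc 0 l) s 1 = w := by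
      have := hd.derivWithin hu
      rwa [← fderivWithin_derivWithin] at this
    have e2 : ∀ (A : EuclideanSpace ℝ (Fin (n + 1)) →L[ℝ] EuclideanSpace ℝ (Fin (n + 1)))
        (B : ℝ →L[ℝ] EuclideanSpace ℝ (Fin (n + 1))), B 1 = w → (A.comp B) 1 = A w := by
      intro A B hB
      rw [ContinuousLinearMap.comp_apply, hB]
    exact (congrArg (fun L : ℝ →L[ℝ] EuclideanSpace ℝ (Fin (n + 1)) => L 1) key).trans
      (e2 _ _ e1)
  refine ⟨MDifferentiableWithinAt.comp (u := (extChartAt (𝓡 (n + 1)) p).target)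
    (g := (extChartAt (𝓡 (n + 1)) p).symm) s hmd' hmd hmaps, ?_, ?_⟩
  · rw [hv]; exact h2
  · rw [hv]; exact h3

lemma near (hg : IsLorentzMetric g) (hT : IsTimeOrientation g T) {τ : M → ℝ}
    (hτ : Continuous τ) (p : M) {ε : ℝ} (hε : 0 < ε) :
    ∀ᶠ q in 𝓝 p, ∃ L < ε, Reach g T τ p q L := by
  obtain ⟨r, hr, hcone⟩ := cone_nhds hg hT p
  set φ := extChartAt (𝓡 (n + 1)) p with hφ
  set y0 := φ p with hy0
  set w0 := cT T p y0 with hw0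
  have hps : p ∈ φ.source := mem_extChartAt_source p
  have hp0 : φ.symm y0 = p := φ.left_inv hps
  have hcont : ContinuousAt (fun y => τ (φ.symm y)) y0 :=
    hτ.continuousAt.comp (continuousAt_extChartAt_symm p)
  have hev : ∀ᶠ y in 𝓝 y0, |τ (φ.symm y) - τ p| < ε / 3 := by
    have := Metric.continuousAt_iff'.1 hcont (ε / 3) (by positivity)
    simpa [Real.dist_eq, hp0] using this
  obtain ⟨ρ', hρ', hτρ'⟩ := Metric.eventually_nhds_iff_ball.1 hev
  obtain ⟨ρ, hρ, hρr, hτρ⟩ : ∃ ρ > 0, ρ ≤ r ∧ ∀ y ∈ Metric.ball y0 ρ,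
      |τ (φ.symm y) - τ p| < ε / 3 :=
    ⟨min ρ' r, lt_min hρ' hr, min_le_right _ _,
      fun y hy => hτρ' y (Metric.ball_subset_ball (min_le_left _ _) hy)⟩
  set l : ℝ := ρ / (2 * (‖w0‖ + 1)) with hl
  have hlpos : 0 < l := by positivity
  have hlw : l * ‖w0‖ < ρ / 2 := by
    have : l * (‖w0‖ + 1) = ρ / 2 := by rw [hl]; field_simp
    nlinarith
  have hcq : ContinuousAt φ p := continuousAt_extChartAt p
  filter_upwards [(isOpen_extChartAt_source (I := 𝓡 (n + 1)) p).mem_nhds hps,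
    hcq.eventually (Metric.ball_mem_nhds y0 (show 0 < min (ρ / 2) (l * r) by positivity))]
    with q hqs hq
  set v := φ q - y0 with hv
  have hvn : ‖v‖ < min (ρ / 2) (l * r) := by rw [hv, ← dist_eq_norm]; exact hq
  have hv1 := hvn.trans_le (min_le_left _ _)
  have hv2 := hvn.trans_le (min_le_right _ _)
  have hin1 : ∀ s ∈ Icc 0 l, y0 + s • w0 ∈ Metric.ball y0 ρ := by
    intro s hs
    rw [Metric.mem_ball, dist_eq_norm, add_sub_cancel_left, norm_smul, Real.norm_of_nonneg hs.1]
    nlinarith [mul_le_mul_of_nonneg_right hs.2 (norm_nonneg w0)]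
  have hin2 : ∀ s ∈ Icc 0 l, φ q + s • (w0 - l⁻¹ • v) ∈ Metric.ball y0 ρ := by
    intro s hs
    have e : φ q + s • (w0 - l⁻¹ • v) - y0 = s • w0 + (1 - s * l⁻¹) • v := by
      rw [hv]; module
    have hsl : s * l⁻¹ ≤ 1 := by rw [← div_eq_mul_inv, div_le_one hlpos]; exact hs.2
    have hsl0 : 0 ≤ s * l⁻¹ := mul_nonneg hs.1 (by positivity)
    rw [Metric.mem_ball, dist_eq_norm, e]
    refine (norm_add_le _ _).trans_lt ?_
    rw [norm_smul, norm_smul, Real.norm_of_nonneg hs.1, Real.norm_of_nonneg (by linarith)]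
    nlinarith [mul_le_mul_of_nonneg_right hs.2 (norm_nonneg w0),
      mul_nonneg hsl0 (norm_nonneg v)]
  have hw2 : w0 - l⁻¹ • v ∈ Metric.ball w0 r := by
    rw [Metric.mem_ball, dist_eq_norm, sub_sub_cancel_left, norm_neg, norm_smul,
      Real.norm_of_nonneg (by positivity), inv_mul_lt_iff₀ hlpos]
    exact hv2
  have s1 := line_step (g := g) (T := T) p (y := y0) (w := w0) hlpos (fun s hs =>
    hcone _ (Metric.ball_subset_ball hρr (hin1 s hs)) _ (Metric.mem_ball_self hr))
  have s2 := line_step (g := g) (T := T) p (y := φ q) (w := w0 - l⁻¹ • v) hlpos (fun s hs =>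
    hcone _ (Metric.ball_subset_ball hρr (hin2 s hs)) _ hw2)
  have hend : φ q + l • (w0 - l⁻¹ • v) = y0 + l • w0 := by
    rw [smul_sub, smul_smul, mul_inv_cancel₀ hlpos.ne', hv]; module
  rw [hend] at s2
  change FStep g T (φ.symm y0) (φ.symm (y0 + l • w0)) at s1
  change FStep g T (φ.symm (φ q)) (φ.symm (y0 + l • w0)) at s2
  rw [hp0] at s1
  rw [φ.left_inv hqs] at s2
  refine ⟨_, ?_, (Reach.single (τ := τ) (Or.inl s1)).tail (Or.inr s2)⟩
  have t1 := hτρ _ (hin1 l ⟨hlpos.le, le_rfl⟩)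
  have t2 := hτρ _ (hin2 0 ⟨le_rfl, hlpos.le⟩)
  rw [zero_smul, add_zero, φ.left_inv hqs] at t2
  have t3 := abs_sub_le (τ q) (τ p) (τ (φ.symm (y0 + l • w0)))
  rw [abs_sub_comm (τ p)] at t3
  linarith

lemma reach_all [ConnectedSpace M] (hg : IsLorentzMetric g) (hT : IsTimeOrientation g T)
    {τ : M → ℝ} (hτ : Continuous τ) (p q : M) : ∃ L, Reach g T τ p q L := by
  have hnear := fun x => near hg hT hτ x one_pos
  have hopen : IsOpen {q | ∃ L, Reach g T τ p q L} := by
    rw [isOpen_iff_mem_nhds]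
    rintro x ⟨L, hL⟩
    filter_upwards [hnear x] with y hy
    obtain ⟨L', -, hL'⟩ := hy
    exact ⟨_, hL.trans hL'⟩
  have hclosed : IsClosed {q | ∃ L, Reach g T τ p q L} := by
    rw [← isOpen_compl_iff, isOpen_iff_mem_nhds]
    intro x hx
    filter_upwards [hnear x] with y hy
    rintro ⟨L, hL⟩
    obtain ⟨L', -, hL'⟩ := hy
    exact hx ⟨_, hL.trans hL'.symm⟩
  have huniv := IsClopen.eq_univ ⟨hclosed, hopen⟩ (by
    obtain ⟨L, -, hL⟩ := (hnear p).self_of_nhds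
    exact ⟨p, L, hL⟩)
  have : q ∈ {q | ∃ L, Reach g T τ p q L} := huniv ▸ mem_univ q
  exact this

end helpers2

end SpacetimeNullDist

open SpacetimeNullDist

/-- **Theorem 4.6 of Sormani–Vega (`thm-BasicNullProperties`).**
Let `M` be a (connected) spacetime, i.e. a time-oriented Lorentzian manifold,
and `τ` a time function on `M`.  If `τ` is locally anti-Lipschitz, then the
induced null distance `d̂_τ` is a definite, conformally invariant metric on `M`
which induces the manifold topology. -/
theorem nullDist_definite_conformallyInvariant_inducesTopology
    {n : ℕ} {M : Type*} [TopologicalSpace M] [T2Space M] [ConnectedSpace M]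
    [ChartedSpace (EuclideanSpace ℝ (Fin (n + 1))) M]
    [IsManifold (𝓡 (n + 1)) (⊤ : ℕ∞) M]
    (g : ∀ x : M, TangentSpace (𝓡 (n + 1)) x → TangentSpace (𝓡 (n + 1)) x → ℝ)
    (T : ∀ x : M, TangentSpace (𝓡 (n + 1)) x)
    (hg : IsLorentzMetric g) (hT : IsTimeOrientation g T)
    (τ : M → ℝ) (hτ : IsTimeFunction g T τ)
    (hAL : LocallyAntiLipschitz g T τ) :
    -- `d̂_τ` is a definite metric on `M`:
    (∀ p q : M, 0 ≤ nullDist g T τ p q) ∧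
    (∀ p q : M, nullDist g T τ p q = nullDist g T τ q p) ∧
    (∀ p q r : M, nullDist g T τ p r ≤ nullDist g T τ p q + nullDist g T τ q r) ∧
    (∀ p q : M, nullDist g T τ p q = 0 ↔ p = q) ∧
    -- `d̂_τ` is conformally invariant:
    (∀ Ω : M → ℝ, (∀ x, 0 < Ω x) →
      nullDist (fun x u v => Ω x * g x u v) T τ = nullDist g T τ) ∧
    -- `d̂_τ` induces the manifold topology:
    (∀ p : M, (𝓝 p).HasBasis (fun ε : ℝ => 0 < ε)
      (fun ε => {q | nullDist g T τ p q < ε})) := by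
  obtain ⟨hsymm, hlin, -, -⟩ := id hg
  have hset : ∀ p q, {L : ℝ | ∃ β : PiecewiseCausal g T p q, L = nullLength τ β}
      = {L | Reach g T τ p q L} := fun p q => Set.ext fun L => reach_iff hsymm hlin τ p q L
  have hnd : ∀ p q, nullDist g T τ p q = sInf {L | Reach g T τ p q L} := fun p q => by
    rw [nullDist, hset]
  have hbdd : ∀ p q, BddBelow {L | Reach g T τ p q L} := fun p q =>
    ⟨0, fun L hL => Reach.nonneg hL⟩
  have hne : ∀ p q, {L | Reach g T τ p q L}.Nonempty := fun p q => reach_all hg hT hτ.1 p q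
  have hle : ∀ {p q L}, Reach g T τ p q L → nullDist g T τ p q ≤ L := fun {p q L} h => by
    rw [hnd]; exact csInf_le (hbdd p q) h
  have hlt : ∀ {p q ε}, nullDist g T τ p q < ε → ∃ L < ε, Reach g T τ p q L := by
    intro p q ε h
    rw [hnd] at h
    obtain ⟨L, hL, hLε⟩ := exists_lt_of_csInf_lt (hne p q) h
    exact ⟨L, hLε, hL⟩
  have hnonneg : ∀ p q, 0 ≤ nullDist g T τ p q := fun p q => by
    rw [hnd]; exact Real.sInf_nonneg fun L hL => Reach.nonneg hL
  have hself : ∀ p, nullDist g T τ p p = 0 := fun p => by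
    refine le_antisymm (le_of_forall_pos_lt_add fun ε hε => ?_) (hnonneg p p)
    obtain ⟨L, hL, hr⟩ := (near hg hT hτ.1 p hε).self_of_nhds
    linarith [hle hr]
  haveI : LocallyCompactSpace M := Manifold.locallyCompact_of_finiteDimensional (𝓡 (n + 1))
  have hsmall : ∀ p : M, ∀ t ∈ 𝓝 p, ∃ ε > 0, ∀ q, nullDist g T τ p q < ε → q ∈ t := by
    intro p t ht
    obtain ⟨U, hU, d, hd, htri, hbasis, hal⟩ := hAL p
    have hpU : p ∈ U := mem_of_mem_nhds hU
    obtain ⟨K, hKn, hKc, hKt⟩ := exists_mem_nhds_isClosed_subset (inter_mem ht hU)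
    obtain ⟨ε, hε, hsub⟩ := (hbasis p hpU).mem_iff.1
      (mem_nhdsWithin_of_mem_nhds (interior_mem_nhds.2 hKn))
    refine ⟨ε, hε, fun q hq => ?_⟩
    obtain ⟨L, hL, hr⟩ := hlt hq
    have := reach_control hsymm hlin hτ hpU hd htri hal hKc (fun x hx => (hKt hx).2) hsub hr hL
    exact (hKt (interior_subset (hsub ⟨this.1, this.2.trans_lt hL⟩))).1
  refine ⟨hnonneg, ?_, ?_, ?_, ?_, ?_⟩
  · intro p q
    rw [hnd, hnd]
    congr 1
    exact Set.ext fun L => ⟨Reach.symm, Reach.symm⟩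
  · intro p q r
    refine le_of_forall_pos_lt_add fun ε hε => ?_
    obtain ⟨L, hL, hr⟩ := hlt (show nullDist g T τ p q < nullDist g T τ p q + ε / 2 by linarith)
    obtain ⟨L', hL', hr'⟩ :=
      hlt (show nullDist g T τ q r < nullDist g T τ q r + ε / 2 by linarith)
    linarith [hle (hr.trans hr')]
  · intro p q
    refine ⟨fun h => ?_, fun h => h ▸ hself p⟩
    by_contra hne'
    obtain ⟨ε, hε, hs⟩ := hsmall p {q}ᶜ (isOpen_compl_singleton.mem_nhds hne')
    exact hs q (h ▸ hε) rfl
  · intro Ω hΩ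
    have hF : ∀ γ a b, FutureCausalOn (fun x u v => Ω x * g x u v) T γ a b ↔
        FutureCausalOn g T γ a b := by
      intro γ a b
      simp only [FutureCausalOn, mul_nonpos_iff_of_pos_left' (hΩ _), mul_neg_iff_of_pos' (hΩ _)]
    have hS : ∀ p q, FStep (fun x u v => Ω x * g x u v) T p q ↔ FStep g T p q := by
      intro p q
      simp only [FStep, hF]
    have hsymm' : ∀ x u v, (fun x u v => Ω x * g x u v : ∀ x : M, TangentSpace (𝓡 (n + 1)) x →
        TangentSpace (𝓡 (n + 1)) x → ℝ) x u v = Ω x * g x v u := fun x u v => by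
      simp only [hsymm x u v]
    have hlin' : ∀ x u, IsLinearMap ℝ (fun v => Ω x * g x u v) := fun x u =>
      ⟨fun a b => by rw [(hlin x u).map_add]; ring,
       fun c a => by rw [(hlin x u).map_smul, smul_eq_mul, smul_eq_mul]; ring⟩
    have hR : ∀ p q L, Reach (fun x u v => Ω x * g x u v) T τ p q L ↔ Reach g T τ p q L := by
      intro p q L
      constructor
      · intro h
        induction h with
        | single h1 => exact .single (by simpa only [hS] using h1)
        | tail _ h1 ih => exact ih.tail (by simpa only [hS] using h1)
      · intro h
        induction h with
        | single h1 => exact .single (by simpa only [hS] using h1)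
        | tail _ h1 ih => exact ih.tail (by simpa only [hS] using h1)
    funext p q
    rw [hnd, nullDist]
    congr 1
    exact Set.ext fun L => (reach_iff hsymm' hlin' τ p q L).trans (hR p q L)
  · intro p
    refine ⟨fun t => ⟨fun ht => ?_, ?_⟩⟩
    · obtain ⟨ε, hε, hs⟩ := hsmall p t ht
      exact ⟨ε, hε, fun q hq => hs q hq⟩
    · rintro ⟨ε, hε, hs⟩
      filter_upwards [near hg hT hτ.1 p hε] with q hq
      obtain ⟨L, hL, hr⟩ := hq
      exact hs ((hle hr).trans_lt hL)
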